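/- Let B be a predicate on (s,t)-cuts whose satisfying family is closed under pairwise union and pairwise intersection (a regular predicate), and let F be the family of min-cuts S satisfying B. Then the number of join-irreducible members of F is at most |V|. -/

import Mathlib

open scoped Classical

/-- An `(s,t)`-cut: a set of vertices containing `s` but not `t`. -/
def IsCut {V : Type*} (s t : V) (S : Set V) : Prop := s ∈ S ∧ t ∉ S

/-- The capacity of a cut `S`. -/
noncomputable def cutCap {V : Type*} [Fintype V] (c : V → V → NNReal) (S : Set V) : NNReal :=
  ∑ u : V, ∑ v : V, if u ∈ S ∧ v ∉ S then c u v else 0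

/-- A minimum `(s,t)`-cut. -/
def IsMinCut {V : Type*} [Fintype V] (s t : V) (c : V → V → NNReal) (S : Set V) : Prop :=
  IsCut s t S ∧ ∀ S', IsCut s t S' → cutCap c S ≤ cutCap c S'

/-- `X` is join-irreducible in the family `F`: `X ∈ F` and whenever `X = A ∪ B` with
`A, B ∈ F`, then `A = X` or `B = X`. -/
def JoinIrred {α : Type*} (F : Set (Set α)) (X : Set α) : Prop :=
  X ∈ F ∧ ∀ A B : Set α, A ∈ F → B ∈ F → X = A ∪ B → A = X ∨ B = X

theorem cutCap_union_add_cutCap_inter_le {V : Type*} [Fintype V] (c : V → V → NNReal)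
    (S T : Set V) :
    cutCap c (S ∪ T) + cutCap c (S ∩ T) ≤ cutCap c S + cutCap c T := by
  unfold cutCap
  simp only [← Finset.sum_add_distrib]
  refine Finset.sum_le_sum fun u _ => Finset.sum_le_sum fun v _ => ?_
  by_cases h₁ : u ∈ S <;> by_cases h₂ : u ∈ T <;> by_cases h₃ : v ∈ S <;>
    by_cases h₄ : v ∈ T <;> simp [h₁, h₂, h₃, h₄]

theorem IsCut.union {V : Type*} {s t : V} {S T : Set V} (hS : IsCut s t S) (hT : IsCut s t T) :
    IsCut s t (S ∪ T) :=
  ⟨Or.inl hS.1, fun h => h.elim hS.2 hT.2⟩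

theorem IsCut.inter {V : Type*} {s t : V} {S T : Set V} (hS : IsCut s t S) (hT : IsCut s t T) :
    IsCut s t (S ∩ T) :=
  ⟨⟨hS.1, hT.1⟩, fun h => hS.2 h.1⟩

theorem IsMinCut.union {V : Type*} [Fintype V] {s t : V} {c : V → V → NNReal} {S T : Set V}
    (hS : IsMinCut s t c S) (hT : IsMinCut s t c T) : IsMinCut s t c (S ∪ T) := by
  refine ⟨hS.1.union hT.1, fun S' hS' => ?_⟩
  have hsub := cutCap_union_add_cutCap_inter_le c S T
  have hST := hS.2 _ (hS.1.inter hT.1)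
  have h : cutCap c (S ∪ T) ≤ cutCap c T :=
    le_of_add_le_add_right (hsub.trans (by rw [add_comm]; gcongr))
  exact h.trans (hT.2 S' hS')

theorem IsMinCut.inter {V : Type*} [Fintype V] {s t : V} {c : V → V → NNReal} {S T : Set V}
    (hS : IsMinCut s t c S) (hT : IsMinCut s t c T) : IsMinCut s t c (S ∩ T) := by
  refine ⟨hS.1.inter hT.1, fun S' hS' => ?_⟩
  have hsub := cutCap_union_add_cutCap_inter_le c S T
  have hST := hS.2 _ (hS.1.union hT.1)
  have h : cutCap c (S ∩ T) ≤ cutCap c T :=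
    le_of_add_le_add_left (hsub.trans (by gcongr))
  exact h.trans (hT.2 S' hS')

/-- In a finite family closed under union and intersection, every nonempty join-irreducible
member is the least member containing some point. -/
theorem JoinIrred.exists_mem_forall_subset {α : Type*} [Finite α] {F : Set (Set α)} {X : Set α}
    (hX : JoinIrred F X) (hne : X.Nonempty)
    (hunion : ∀ A ∈ F, ∀ B ∈ F, A ∪ B ∈ F) (hinter : ∀ A ∈ F, ∀ B ∈ F, A ∩ B ∈ F) :
    ∃ v ∈ X, ∀ A ∈ F, v ∈ A → X ⊆ A := by
  by_contra! H
  have key : ∀ v ∈ X, ∃ A, (A ∈ F ∧ A ⊂ X) ∧ v ∈ A := by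
    intro v hv
    obtain ⟨A, hA, hvA, hXA⟩ := H v hv
    exact ⟨A ∩ X, ⟨hinter A hA X hX.1, Set.inter_subset_right,
      fun h => hXA fun x hx => (h hx).1⟩, hvA, hv⟩
  obtain ⟨x, hx⟩ := hne
  obtain ⟨A₀, hA₀, -⟩ := key x hx
  obtain ⟨A, hA⟩ := (Set.toFinite {A : Set α | A ∈ F ∧ A ⊂ X}).exists_maximal ⟨A₀, hA₀⟩
  obtain ⟨hAF, hAX⟩ := hA.prop
  obtain ⟨v, hvX, hvA⟩ := Set.exists_of_ssubset hAX
  obtain ⟨A', ⟨hA'F, hA'X⟩, hvA'⟩ := key v hvX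
  have hne : A ∪ A' ≠ X := fun h =>
    (hX.2 A A' hAF hA'F h.symm).elim hAX.ne hA'X.ne
  have hmem : A ∪ A' ∈ {A : Set α | A ∈ F ∧ A ⊂ X} :=
    ⟨hunion A hAF A' hA'F, (Set.union_subset hAX.subset hA'X.subset).ssubset_of_ne hne⟩
  exact hvA (hA.le_of_ge hmem Set.subset_union_left (Or.inr hvA'))

theorem ncard_joinIrred_le {α : Type*} [Fintype α] {F : Set (Set α)}
    (hne : ∀ A ∈ F, A.Nonempty)
    (hunion : ∀ A ∈ F, ∀ B ∈ F, A ∪ B ∈ F) (hinter : ∀ A ∈ F, ∀ B ∈ F, A ∩ B ∈ F) :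
    {X : Set α | JoinIrred F X}.ncard ≤ Fintype.card α := by
  have key : ∀ X : {X : Set α | JoinIrred F X}, ∃ v ∈ X.1, ∀ A ∈ F, v ∈ A → X.1 ⊆ A :=
    fun X => X.2.exists_mem_forall_subset (hne _ X.2.1) hunion hinter
  choose f hfmem hfmin using key
  have hf : Function.Injective f := fun X Y h => Subtype.ext <| Set.Subset.antisymm
    (hfmin X _ Y.2.1 (h ▸ hfmem Y)) (hfmin Y _ X.2.1 (h ▸ hfmem X))
  rw [← Nat.card_coe_set_eq, ← Nat.card_eq_fintype_card]
  exact Nat.card_le_card_of_injective f hf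

/-- If `B` is a regular predicate on `(s,t)`-cuts (its satisfying family of cuts is
closed under pairwise union and intersection), then the family `F` of min-cuts
satisfying `B` has at most `|V|` join-irreducible members. -/
theorem card_joinIrred_le {V : Type*} [Fintype V] (s t : V) (hst : s ≠ t)
    (c : V → V → NNReal) (B : Set V → Prop)
    (hUnion : ∀ S T : Set V, IsCut s t S → IsCut s t T → B S → B T → B (S ∪ T))
    (hInter : ∀ S T : Set V, IsCut s t S → IsCut s t T → B S → B T → B (S ∩ T)) :
    {X : Set V | JoinIrred {S : Set V | IsMinCut s t c S ∧ B S} X}.ncard ≤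
      Fintype.card V := by
  exact ncard_joinIrred_le (fun A hA => ⟨s, hA.1.1.1⟩)
    (fun A hA A' hA' => ⟨hA.1.union hA'.1, hUnion A A' hA.1.1 hA'.1.1 hA.2 hA'.2⟩)
    (fun A hA A' hA' => ⟨hA.1.inter hA'.1, hInter A A' hA.1.1 hA'.1.1 hA.2 hA'.2⟩)
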